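/- arXiv:1801.05663 — 4 statements merged into one kernel-verified Lean document; each statement's English description precedes it below -/
import Mathlib

section
/- There exists a constant C > 0 such that for every integer N ≥ 1, every dimension d ≥ 1 and every w ∈ [−Nπ/2, Nπ/2]^d with w ≠ 0, one has ‖w‖^{−4} ≤ N^{−4} (Σ_{i=1}^d sin²(w_i/N))^{−2} ≤ (‖w‖^{−2} + C N^{−2})². -/
open scoped Real BigOperators

lemma aux_coord (x : ℝ) (hx : |x| ≤ π / 2) :
    x ^ 2 ≤ Real.sin x ^ 2 + x ^ 2 * Real.sin x ^ 2 := by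
  have key : ∀ y : ℝ, 0 ≤ y → y ≤ π / 2 →
      y ^ 2 ≤ Real.sin y ^ 2 + y ^ 2 * Real.sin y ^ 2 := by
    intro y h0 h1
    have hc : 0 ≤ Real.cos y := Real.cos_nonneg_of_mem_Icc ⟨by linarith [Real.pi_pos], h1⟩
    have h : y * Real.cos y ≤ Real.sin y := by
      rcases h1.lt_or_eq with h1 | h1
      · have hc' : 0 < Real.cos y := Real.cos_pos_of_mem_Ioo ⟨by linarith [Real.pi_pos], h1⟩
        have := Real.le_tan h0 h1
        rwa [Real.tan_eq_sin_div_cos, le_div_iff₀ hc'] at this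
      · rw [h1]; simp
    have h2 := pow_le_pow_left₀ (mul_nonneg h0 hc) h 2
    rw [mul_pow, Real.cos_sq'] at h2
    linarith
  rcases abs_cases x with ⟨h, h'⟩ | ⟨h, h'⟩
  · exact key x h' (h ▸ hx)
  · simpa using key (-x) (by linarith) (h ▸ hx)

/-- There is a universal constant `C > 0` such that for every integer
`N ≥ 1`, every dimension `d ≥ 1` and every `w ∈ [-Nπ/2, Nπ/2]^d` with `w ≠ 0`,
`‖w‖^{-4} ≤ N^{-4} (Σ_i sin²(w_i/N))^{-2} ≤ (‖w‖^{-2} + C N^{-2})²`. -/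
theorem statement3 :
    ∃ C : ℝ, 0 < C ∧ ∀ N : ℕ, 1 ≤ N → ∀ d : ℕ, 1 ≤ d →
      ∀ w : EuclideanSpace ℝ (Fin d), (∀ i, |w i| ≤ N * Real.pi / 2) → w ≠ 0 →
        ‖w‖ ^ (-4 : ℝ) ≤ (N : ℝ) ^ (-4 : ℝ) * ((∑ i, Real.sin (w i / N) ^ 2)⁻¹) ^ 2 ∧
        (N : ℝ) ^ (-4 : ℝ) * ((∑ i, Real.sin (w i / N) ^ 2)⁻¹) ^ 2
          ≤ (‖w‖ ^ (-2 : ℝ) + C * (N : ℝ) ^ (-2 : ℝ)) ^ 2 := by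
  refine ⟨1, one_pos, ?_⟩
  intro N hN d _ w hw hw0
  have hNp : (0 : ℝ) < N := by exact_mod_cast hN
  have hn : 0 < ‖w‖ := norm_pos_iff.mpr hw0
  have e4 : ∀ a : ℝ, 0 < a → a ^ (-4 : ℝ) = ((a ^ 2)⁻¹) ^ 2 := by
    intro a ha
    rw [Real.rpow_neg ha.le, show (4 : ℝ) = ((4 : ℕ) : ℝ) by norm_num, Real.rpow_natCast,
      inv_pow, ← pow_mul]
  have e2 : ∀ a : ℝ, 0 < a → a ^ (-2 : ℝ) = (a ^ 2)⁻¹ := by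
    intro a ha
    rw [Real.rpow_neg ha.le, show (2 : ℝ) = ((2 : ℕ) : ℝ) by norm_num, Real.rpow_natCast]
  rw [e4 _ hn, e4 _ hNp, e2 _ hn, e2 _ hNp]
  have hR : ‖w‖ ^ 2 = (N : ℝ) ^ 2 * ∑ i, (w i / N) ^ 2 := by
    rw [EuclideanSpace.real_norm_sq_eq, Finset.mul_sum]
    refine Finset.sum_congr rfl fun i _ => ?_
    field_simp
  rw [hR]
  have hR0 : 0 < ∑ i, (w i / N) ^ 2 := by
    have : 0 < ‖w‖ ^ 2 := by positivity
    rw [hR] at this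
    exact pos_of_mul_pos_right this (by positivity)
  have hS0 : 0 ≤ ∑ i, Real.sin (w i / N) ^ 2 := Finset.sum_nonneg fun i _ => sq_nonneg _
  have hSR : ∑ i, Real.sin (w i / N) ^ 2 ≤ ∑ i, (w i / N) ^ 2 :=
    Finset.sum_le_sum fun i _ => sq_le_sq.mpr Real.abs_sin_le_abs
  have hRS : ∑ i, (w i / N) ^ 2 ≤ ∑ i, Real.sin (w i / N) ^ 2 +
      (∑ i, (w i / N) ^ 2) * ∑ i, Real.sin (w i / N) ^ 2 := by
    rw [Finset.sum_mul, ← Finset.sum_add_distrib]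
    refine Finset.sum_le_sum fun i _ => ?_
    refine (aux_coord (w i / N) ?_).trans ?_
    · rw [abs_div, abs_of_pos hNp, div_le_iff₀ hNp]
      linarith [hw i]
    · gcongr
      exact Finset.single_le_sum (f := fun i => Real.sin (w i / N) ^ 2)
        (fun i _ => sq_nonneg _) (Finset.mem_univ i)
  generalize (∑ i, (w i / N) ^ 2) = R at *
  generalize (∑ i, Real.sin (w i / N) ^ 2) = S at *
  have hS : 0 < S := by
    rcases hS0.lt_or_eq with h | h
    · exact h
    · rw [← h] at hRS; linarith
  have h1 : R⁻¹ ≤ S⁻¹ := inv_anti₀ hS hSR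
  have h2 : S⁻¹ ≤ R⁻¹ + 1 := by
    have : R⁻¹ + 1 - S⁻¹ = (S + R * S - R) / (R * S) := by field_simp
    have h3 : 0 ≤ (S + R * S - R) / (R * S) := div_nonneg (by linarith) (by positivity)
    linarith
  rw [← mul_pow, mul_inv]
  constructor
  · gcongr
  · have : ((N : ℝ) ^ 2)⁻¹ * R⁻¹ + 1 * ((N : ℝ) ^ 2)⁻¹ = ((N : ℝ) ^ 2)⁻¹ * (R⁻¹ + 1) := by ring
    rw [this]
    gcongr
end

section
/- Let d ≥ 1 and let V ⊂ ℝ^d be a nonempty bounded open set satisfying the uniform exterior ball condition. Then there exists h₀ > 0 such that for every h with 0 < h < h₀ and every x ∈ B_h^*, there exist an index i ∈ {1, …, d}, a sign σ ∈ {−1, +1} and k ∈ {1, 2, 3} such that both x + σ k h e_i ∈ B_h and x + σ (k+1) h e_i ∈ B_h; in other words, some coordinate half-ray from x contains within distance 4h two consecutive grid points lying in B_h (so property 𝓑₂* holds for V). -/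
open scoped Real

/-- The `i`-th standard basis vector of `ℝ^d`. -/
noncomputable def stdB (d : ℕ) (i : Fin d) : EuclideanSpace ℝ (Fin d) :=
  EuclideanSpace.single i 1

/-- The uniform exterior ball condition: there is `δ > 0` such that every boundary point
`z` of `V` is touched by a closed exterior ball of radius `δ` meeting `closure V`
only at `z`. -/
def UEBC {d : ℕ} (V : Set (EuclideanSpace ℝ (Fin d))) : Prop :=
  ∃ δ : ℝ, 0 < δ ∧ ∀ z ∈ frontier V, ∃ c : EuclideanSpace ℝ (Fin d),
    Metric.closedBall c δ ∩ closure V = {z}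

/-- The grid `hℤ^d` inside `ℝ^d`. -/
def hGrid (d : ℕ) (h : ℝ) : Set (EuclideanSpace ℝ (Fin d)) :=
  {ξ | ∀ i, ∃ n : ℤ, ξ i = h * n}

/-- The neighbourhood `N(ξ) = {ξ ± h e_i, ξ ± h e_i ± h e_j : 1 ≤ i, j ≤ d}`. -/
def nbhd (d : ℕ) (h : ℝ) (ξ : EuclideanSpace ℝ (Fin d)) : Set (EuclideanSpace ℝ (Fin d)) :=
  {y | (∃ (i : Fin d) (σ : ℝ), (σ = 1 ∨ σ = -1) ∧ y = ξ + (σ * h) • stdB d i) ∨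
       (∃ (i j : Fin d) (σ τ : ℝ), (σ = 1 ∨ σ = -1) ∧ (τ = 1 ∨ τ = -1) ∧
          y = ξ + (σ * h) • stdB d i + (τ * h) • stdB d j)}

/-- `V_h = closure V ∩ hℤ^d`: the grid points of `closure V`. -/
def Vh {d : ℕ} (V : Set (EuclideanSpace ℝ (Fin d))) (h : ℝ) : Set (EuclideanSpace ℝ (Fin d)) :=
  closure V ∩ hGrid d h

/-- `R_h`: interior grid points, those whose whole neighbourhood lies in `V_h`. -/
def Rh {d : ℕ} (V : Set (EuclideanSpace ℝ (Fin d))) (h : ℝ) : Set (EuclideanSpace ℝ (Fin d)) :=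
  {ξ ∈ Vh V h | nbhd d h ξ ⊆ Vh V h}

/-- `B_h = V_h \ R_h`: boundary grid points. -/
def Bh {d : ℕ} (V : Set (EuclideanSpace ℝ (Fin d))) (h : ℝ) : Set (EuclideanSpace ℝ (Fin d)) :=
  Vh V h \ Rh V h

/-- `R_h^*`: points of `R_h` whose whole neighbourhood lies in `R_h`. -/
def Rhstar {d : ℕ} (V : Set (EuclideanSpace ℝ (Fin d))) (h : ℝ) : Set (EuclideanSpace ℝ (Fin d)) :=
  {ξ ∈ Rh V h | nbhd d h ξ ⊆ Rh V h}

/-- `B_h^* = R_h \ R_h^*`. -/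
def Bhstar {d : ℕ} (V : Set (EuclideanSpace ℝ (Fin d))) (h : ℝ) : Set (EuclideanSpace ℝ (Fin d)) :=
  Rh V h \ Rhstar V h

lemma aux_coord_s7 (d : ℕ) (x : EuclideanSpace ℝ (Fin d)) (a : ℝ) (i j : Fin d) :
    (x + a • stdB d i) j = x j + if j = i then a else 0 := by
  simp [stdB, Pi.single_apply]

lemma aux_grid (d : ℕ) (h : ℝ) (x : EuclideanSpace ℝ (Fin d)) (hx : x ∈ hGrid d h)
    (m : ℤ) (a : ℝ) (ha : a = h * m) (i : Fin d) : x + a • stdB d i ∈ hGrid d h := by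
  intro j
  obtain ⟨n, hn⟩ := hx j
  rw [aux_coord_s7]
  by_cases hj : j = i
  · exact ⟨n + m, by simp only [hj, if_true]; rw [← hj, hn, ha]; push_cast; ring⟩
  · exact ⟨n, by simp [hj, hn]⟩

lemma aux_gridσ (d : ℕ) (h : ℝ) (x : EuclideanSpace ℝ (Fin d)) (hx : x ∈ hGrid d h)
    (σ : ℝ) (hσ : σ = 1 ∨ σ = -1) (m : ℤ) (i : Fin d) :
    x + (σ * m * h) • stdB d i ∈ hGrid d h := by
  rcases hσ with rfl | rfl
  · exact aux_grid d h x hx m _ (by ring) i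
  · exact aux_grid d h x hx (-m) _ (by push_cast; ring) i

lemma aux_nbhd_grid (d : ℕ) (h : ℝ) (x y : EuclideanSpace ℝ (Fin d)) (hx : x ∈ hGrid d h)
    (hy : y ∈ nbhd d h x) : y ∈ hGrid d h := by
  rcases hy with ⟨i, σ, hσ, rfl⟩ | ⟨i, j, σ, τ, hσ, hτ, rfl⟩
  · simpa using aux_gridσ d h x hx σ hσ 1 i
  · have := aux_gridσ d h _ (aux_gridσ d h x hx σ hσ 1 i) τ hτ 1 j
    simpa using this

lemma aux_step_norm (d : ℕ) (h : ℝ) (hh : 0 < h) (σ : ℝ) (hσ : σ = 1 ∨ σ = -1) (i : Fin d) :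
    ‖(σ * h) • stdB d i‖ = h := by
  rcases hσ with rfl | rfl <;> simp [norm_smul, stdB, abs_of_pos hh]

lemma aux_inner (d : ℕ) (a : ℝ) (i : Fin d) (u : EuclideanSpace ℝ (Fin d)) :
    inner ℝ (a • stdB d i) u = a * u i := by
  simp [stdB, inner_smul_left, EuclideanSpace.inner_single_left]

lemma aux_step_inner (d : ℕ) (h : ℝ) (hh : 0 < h) (σ : ℝ) (hσ : σ = 1 ∨ σ = -1) (i : Fin d)
    (u : EuclideanSpace ℝ (Fin d)) (M : ℝ) (hM : ∀ j, |u j| ≤ M) :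
    inner ℝ ((σ * h) • stdB d i) u ≤ h * M := by
  rw [aux_inner]
  have := abs_le.1 (hM i)
  rcases hσ with rfl | rfl <;> nlinarith

lemma aux_nbhd_norm (d : ℕ) (h : ℝ) (hh : 0 < h) (x y : EuclideanSpace ℝ (Fin d))
    (hy : y ∈ nbhd d h x) : ‖y - x‖ ≤ 2 * h := by
  rcases hy with ⟨i, σ, hσ, rfl⟩ | ⟨i, j, σ, τ, hσ, hτ, rfl⟩
  · rw [add_sub_cancel_left, aux_step_norm d h hh σ hσ]; linarith
  · rw [add_assoc, add_sub_cancel_left]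
    refine (norm_add_le _ _).trans ?_
    rw [aux_step_norm d h hh σ hσ, aux_step_norm d h hh τ hτ]; linarith

lemma aux_nbhd_inner (d : ℕ) (h : ℝ) (hh : 0 < h) (x y : EuclideanSpace ℝ (Fin d))
    (hy : y ∈ nbhd d h x) (u : EuclideanSpace ℝ (Fin d)) (M : ℝ) (hM : ∀ j, |u j| ≤ M)
    (hM0 : 0 ≤ M) : inner ℝ (y - x) u ≤ 2 * h * M := by
  rcases hy with ⟨i, σ, hσ, rfl⟩ | ⟨i, j, σ, τ, hσ, hτ, rfl⟩
  · rw [add_sub_cancel_left]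
    have := aux_step_inner d h hh σ hσ i u M hM
    nlinarith
  · rw [add_assoc, add_sub_cancel_left, inner_add_left]
    have := aux_step_inner d h hh σ hσ i u M hM
    have := aux_step_inner d h hh τ hτ j u M hM
    linarith

lemma aux_radius {d : ℕ} (V : Set (EuclideanSpace ℝ (Fin d))) (hopen : IsOpen V) (δ : ℝ)
    (z c : EuclideanSpace ℝ (Fin d)) (hz : z ∈ frontier V)
    (hc : Metric.closedBall c δ ∩ closure V = {z}) : ‖c - z‖ = δ := by
  have hzm : z ∈ Metric.closedBall c δ ∩ closure V := by rw [hc]; rfl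
  have h1 : dist z c ≤ δ := hzm.1
  rw [← dist_eq_norm, dist_comm]
  by_contra hne
  have hlt : dist z c < δ := lt_of_le_of_ne h1 hne
  obtain ⟨y, hy1, hy2⟩ := mem_closure_iff.1 hzm.2 (Metric.ball c δ) Metric.isOpen_ball hlt
  have : y ∈ ({z} : Set _) := by
    rw [← hc]; exact ⟨Metric.ball_subset_closedBall hy1, subset_closure hy2⟩
  rw [Set.mem_singleton_iff] at this
  subst this
  rw [hopen.frontier_eq] at hz
  exact hz.2 hy2

lemma aux_notR {d : ℕ} (V : Set (EuclideanSpace ℝ (Fin d))) (h : ℝ)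
    (x : EuclideanSpace ℝ (Fin d)) (i : Fin d) (σ : ℝ) (hσ : σ = 1 ∨ σ = -1) (k : ℕ)
    (hx : x ∈ hGrid d h)
    (h1 : x + (σ * k * h) • stdB d i ∈ closure V)
    (h2 : x + (σ * (k + 1) * h) • stdB d i ∈ closure V)
    (h3 : x + (σ * (k + 2) * h) • stdB d i ∉ closure V) :
    x + (σ * k * h) • stdB d i ∈ Bh V h ∧ x + (σ * (k + 1) * h) • stdB d i ∈ Bh V h := by
  have g1 := aux_gridσ d h x hx σ hσ k i
  have g2 := aux_gridσ d h x hx σ hσ (k + 1) i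
  push_cast at g1 g2
  refine ⟨⟨⟨h1, g1⟩, fun hR => h3 ?_⟩, ⟨⟨h2, g2⟩, fun hR => h3 ?_⟩⟩
  · refine (hR.2 (Or.inr ⟨i, i, σ, σ, hσ, hσ, ?_⟩)).1
    module
  · refine (hR.2 (Or.inl ⟨i, σ, hσ, ?_⟩)).1
    module

/-- If a nonempty bounded open set `V ⊂ ℝ^d` satisfies the uniform
exterior ball condition, then for all sufficiently small `h > 0` and every `x ∈ B_h^*`,
some coordinate half-ray from `x` contains, within distance `4h`, two consecutive grid
points lying in `B_h` (property `𝓑₂*`). -/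
theorem statement7 (d : ℕ) (hd : 1 ≤ d) (V : Set (EuclideanSpace ℝ (Fin d)))
    (hne : V.Nonempty) (hopen : IsOpen V) (hbdd : Bornology.IsBounded V)
    (huebc : UEBC V) :
    ∃ h₀ : ℝ, 0 < h₀ ∧ ∀ h : ℝ, 0 < h → h < h₀ →
      ∀ x ∈ Bhstar V h, ∃ (i : Fin d) (σ : ℝ) (k : ℕ),
        (σ = 1 ∨ σ = -1) ∧ 1 ≤ k ∧ k ≤ 3 ∧
        x + (σ * k * h) • stdB d i ∈ Bh V h ∧
        x + (σ * (k + 1) * h) • stdB d i ∈ Bh V h := by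
  obtain ⟨δ, hδ, hball⟩ := huebc
  have hd0 : (0 : ℝ) < d := by exact_mod_cast hd
  refine ⟨δ / (81 * d), by positivity, fun h hh hlt x hx => ?_⟩
  obtain ⟨hxR, hxS⟩ := hx
  have hxg : x ∈ hGrid d h := hxR.1.2
  -- the outside point
  obtain ⟨y, hy, hyR⟩ : ∃ y ∈ nbhd d h x, y ∉ Rh V h := by
    by_contra hcon
    push Not at hcon
    exact hxS ⟨hxR, hcon⟩
  have hyV : y ∈ Vh V h := hxR.2 hy
  obtain ⟨w, hw, hwV⟩ : ∃ w ∈ nbhd d h y, w ∉ Vh V h := by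
    by_contra hcon
    push Not at hcon
    exact hyR ⟨hyV, hcon⟩
  have hwc : w ∉ closure V := fun hc => hwV ⟨hc, aux_nbhd_grid d h y w hyV.2 hw⟩
  -- the frontier point
  obtain ⟨z, hzs, hzf⟩ : (segment ℝ x w ∩ frontier (closure V)).Nonempty := by
    by_contra hcon
    have hnf : ∀ p ∈ segment ℝ x w, p ∉ frontier (closure V) := fun p hp hf => hcon ⟨p, hp, hf⟩
    have key : ∀ p ∈ segment ℝ x w, p ∈ closure V → p ∈ interior (closure V) := by
      intro p hp hpc
      by_contra hpi
      exact hnf p hp ⟨subset_closure hpc, hpi⟩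
    obtain ⟨p, -, hp1, hp2⟩ := (convex_segment x w).isPreconnected (interior (closure V))
      (closure V)ᶜ isOpen_interior isClosed_closure.isOpen_compl
      (fun p hp => by
        by_cases hpc : p ∈ closure V
        · exact Or.inl (key p hp hpc)
        · exact Or.inr hpc)
      ⟨x, left_mem_segment ℝ x w, key x (left_mem_segment ℝ x w) hxR.1.1⟩
      ⟨w, right_mem_segment ℝ x w, hwc⟩
    exact hp2 (interior_subset hp1)
  replace hzf : z ∈ frontier V := frontier_closure_subset hzf
  obtain ⟨c, hc⟩ := hball z hzf
  have hr := aux_radius V hopen δ z c hzf hc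
  rw [segment_eq_image'] at hzs
  obtain ⟨t, ⟨ht0, ht1⟩, hzt⟩ := hzs
  simp only at hzt
  set u := c - z with hu
  have : Nonempty (Fin d) := ⟨⟨0, hd⟩⟩
  obtain ⟨i, hi⟩ := Finite.exists_max (fun j : Fin d => |u j|)
  set M := |u i| with hM
  have hM0 : 0 ≤ M := abs_nonneg _
  have hδM : δ ≤ d * M := by
    have e : δ ^ 2 = ∑ j, (u j) ^ 2 := by
      rw [← hr, EuclideanSpace.real_norm_sq_eq]
    have e2 : ∑ j, (u j) ^ 2 ≤ ∑ j : Fin d, M ^ 2 :=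
      Finset.sum_le_sum fun j _ => by
        rw [← sq_abs]; exact pow_le_pow_left₀ (abs_nonneg _) (hi j) 2
    simp only [Finset.sum_const, Finset.card_univ, Fintype.card_fin, nsmul_eq_mul] at e2
    have hd1 : (1 : ℝ) ≤ d := by exact_mod_cast hd
    refine le_of_sq_le_sq ?_ (by positivity)
    have : (d : ℝ) * M ^ 2 ≤ (d * M) ^ 2 := by nlinarith [sq_nonneg M]
    linarith
  have h81 : 81 * h < M := by
    rw [lt_div_iff₀ (by positivity)] at hlt
    have : d * (81 * h) < d * M := by linarith
    exact lt_of_mul_lt_mul_left this hd0.le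
  obtain ⟨σ, hσ, hσu⟩ : ∃ σ : ℝ, (σ = 1 ∨ σ = -1) ∧ σ * u i = M := by
    rcases abs_choice (u i) with h' | h'
    · exact ⟨1, Or.inl rfl, by rw [hM, h']; ring⟩
    · exact ⟨-1, Or.inr rfl, by rw [hM, h']; ring⟩
  -- the fifth point
  have hP5 : x + (σ * 5 * h) • stdB d i ∉ closure V := by
    intro hP
    set P := x + (σ * 5 * h) • stdB d i with hPdef
    have hzx : z - x = t • (w - x) := by rw [← hzt]; abel
    have hwx : w - x = (w - y) + (y - x) := by abel
    have hPz : P - z = (σ * 5 * h) • stdB d i - (z - x) := by rw [hPdef]; abel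
    have n1 : ‖w - x‖ ≤ 4 * h := by
      rw [hwx]
      refine (norm_add_le _ _).trans ?_
      have := aux_nbhd_norm d h hh y w hw
      have := aux_nbhd_norm d h hh x y hy
      linarith
    have n2 : ‖z - x‖ ≤ 4 * h := by
      rw [hzx, norm_smul, Real.norm_of_nonneg ht0]
      nlinarith [norm_nonneg (w - x)]
    have n3 : ‖(σ * 5 * h) • stdB d i‖ = 5 * h := by
      rw [show σ * 5 * h = σ * (5 * h) by ring]
      exact aux_step_norm d (5 * h) (by linarith) σ hσ i
    have n4 : ‖P - z‖ ≤ 9 * h := by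
      rw [hPz]
      refine (norm_sub_le _ _).trans ?_
      linarith
    have i1 : inner ℝ (w - x) u ≤ 4 * h * M := by
      rw [hwx, inner_add_left]
      have := aux_nbhd_inner d h hh y w hw u M hi hM0
      have := aux_nbhd_inner d h hh x y hy u M hi hM0
      linarith
    have i2 : inner ℝ (z - x) u ≤ 4 * h * M := by
      rw [hzx, inner_smul_left]
      simp only [conj_trivial]
      have : 0 ≤ 4 * h * M := by positivity
      nlinarith
    have i3 : h * M ≤ inner ℝ (P - z) u := by
      rw [hPz, inner_sub_left, aux_inner]
      have : σ * 5 * h * u i = 5 * h * M := by rw [← hσu]; ring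
      linarith
    have hMpos : 0 < M := by linarith
    have hPc : P ∈ Metric.closedBall c δ := by
      rw [Metric.mem_closedBall, dist_eq_norm]
      refine le_of_sq_le_sq ?_ hδ.le
      have e : P - c = (P - z) - u := by rw [hu]; abel
      rw [e, norm_sub_sq_real, hr]
      have : ‖P - z‖ ^ 2 ≤ (9 * h) ^ 2 := pow_le_pow_left₀ (norm_nonneg _) n4 2
      nlinarith
    have : P ∈ ({z} : Set _) := by rw [← hc]; exact ⟨hPc, hP⟩
    rw [Set.mem_singleton_iff] at this
    rw [this, sub_self, inner_zero_left] at i3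
    nlinarith
  have c1 : x + (σ * 1 * h) • stdB d i ∈ closure V :=
    (hxR.2 (Or.inl ⟨i, σ, hσ, by module⟩)).1
  have c2 : x + (σ * 2 * h) • stdB d i ∈ closure V :=
    (hxR.2 (Or.inr ⟨i, i, σ, σ, hσ, hσ, by module⟩)).1
  by_cases c3 : x + (σ * 3 * h) • stdB d i ∈ closure V
  · by_cases c4 : x + (σ * 4 * h) • stdB d i ∈ closure V
    · refine ⟨i, σ, 3, hσ, by norm_num, by norm_num, ?_⟩
      apply aux_notR V h x i σ hσ 3 hxg <;> norm_num <;> assumption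
    · refine ⟨i, σ, 2, hσ, by norm_num, by norm_num, ?_⟩
      apply aux_notR V h x i σ hσ 2 hxg <;> norm_num <;> assumption
  · refine ⟨i, σ, 1, hσ, by norm_num, by norm_num, ?_⟩
    rw [mul_one] at c1
    apply aux_notR V h x i σ hσ 1 hxg <;> norm_num <;> assumption
end

section
/- Fix b ∈ (0,1) and A > 0. There exists a constant C > 0 depending only on b and A such that the following holds for every integer N ≥ 2. Let (φ_x)_{x ∈ ℤ²} be a centered Gaussian field with φ_x = 0 almost surely for x ∉ V_{N−1}, whose covariance G(x,y) = E[φ_x φ_y] satisfies, for all x, y ∈ ℤ² and all i, j ∈ {1,2}, |G(x+e_i, y+e_j) − G(x+e_i, y) − G(x, y+e_j) + G(x, y)| ≤ A log(1 + N²/(‖x−y‖+1)²). Let Ψ_N be the piecewise affine interpolation of the rescaled field defined below. Then E[(Ψ_N(t) − Ψ_N(s))²] ≤ C ‖t − s‖^{1+b} for all s, t ∈ [−1,1]². -/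
open MeasureTheory ProbabilityTheory
open scoped BigOperators

/-- The `i`-th standard basis vector of `ℤ²`. -/
def unitZ2 (i : Fin 2) : Fin 2 → ℤ := fun j => if j = i then 1 else 0

/-- Euclidean norm on `ℤ²`. -/
noncomputable def znorm2 (x : Fin 2 → ℤ) : ℝ := Real.sqrt (∑ i, ((x i : ℝ)) ^ 2)

/-- Euclidean norm on `ℝ²`. -/
noncomputable def rnorm2 (t : Fin 2 → ℝ) : ℝ := Real.sqrt (∑ i, (t i) ^ 2)

/-- The covariance `G(x,y) = E[φ_x φ_y]`. -/
noncomputable def covG2 {Ω : Type} [MeasurableSpace Ω] (P : Measure Ω)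
    (φ : (Fin 2 → ℤ) → Ω → ℝ) (x y : Fin 2 → ℤ) : ℝ :=
  ∫ ω, φ x ω * φ y ω ∂P

/-- The piecewise affine interpolation `Ψ_N` (with `κ = 1/4`) of the rescaled field
`(κ/N) φ` on `[-1,1]²`, interpolating over the triangles determined by the ordering of
the fractional parts of `N t`. -/
noncomputable def interp2 {Ω : Type} (N : ℕ) (φ : (Fin 2 → ℤ) → Ω → ℝ)
    (t : Fin 2 → ℝ) (ω : Ω) : ℝ :=
  let a : Fin 2 → ℤ := fun i => ⌊(N : ℝ) * t i⌋
  let fr : Fin 2 → ℝ := fun i => Int.fract ((N : ℝ) * t i)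
  ((1 / 4 : ℝ) / N) *
    (if fr 1 ≤ fr 0 then
      φ a ω + fr 0 * (φ (a + unitZ2 0) ω - φ a ω) +
        fr 1 * (φ (a + unitZ2 0 + unitZ2 1) ω - φ (a + unitZ2 0) ω)
    else
      φ a ω + fr 1 * (φ (a + unitZ2 1) ω - φ a ω) +
        fr 0 * (φ (a + unitZ2 1 + unitZ2 0) ω - φ (a + unitZ2 1) ω))

section Helpers
open Finset

lemma aux_pow_step (b : ℝ) (hb0 : 0 < b) (hb1 : b < 1) (m : ℕ) :
    b * ((m : ℝ) + 1) ^ (b - 1) + (m : ℝ) ^ b ≤ ((m : ℝ) + 1) ^ b := by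
  have hp : (0 : ℝ) < (m : ℝ) + 1 := by positivity
  have hm : (0 : ℝ) ≤ (m : ℝ) := by positivity
  have hq : (-1 : ℝ) ≤ -(1 / ((m : ℝ) + 1)) := by
    have : 1 / ((m : ℝ) + 1) ≤ 1 := by
      rw [div_le_one hp]; linarith
    linarith
  have h := rpow_one_add_le_one_add_mul_self hq hb0.le hb1.le
  have e1 : (1 + -(1 / ((m : ℝ) + 1))) = (m : ℝ) / ((m : ℝ) + 1) := by
    field_simp; ring
  rw [e1, Real.div_rpow hm hp.le] at h
  have hpb : (0 : ℝ) < ((m : ℝ) + 1) ^ b := Real.rpow_pos_of_pos hp b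
  rw [div_le_iff₀ hpb] at h
  rw [Real.rpow_sub_one hp.ne']
  calc _ ≤ b * (((m : ℝ) + 1) ^ b / ((m : ℝ) + 1))
        + (1 + b * -(1 / ((m : ℝ) + 1))) * ((m : ℝ) + 1) ^ b := by linarith
    _ = _ := by field_simp; ring

lemma aux_sum (b : ℝ) (hb0 : 0 < b) (hb1 : b < 1) (m : ℕ) :
    b * ∑ r ∈ range m, ((r : ℝ) + 1) ^ (b - 1) ≤ (m : ℝ) ^ b := by
  induction m with
  | zero => simp [Real.zero_rpow hb0.ne']
  | succ m ih =>
    rw [sum_range_succ, mul_add]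
    have := aux_pow_step b hb0 hb1 m
    push_cast
    linarith

lemma aux_log (p u : ℝ) (hp : 0 < p) (hp1 : p ≤ 1) (hu : 0 ≤ u) :
    Real.log (1 + u) ≤ u ^ p / p := by
  rw [le_div_iff₀ hp, mul_comm, ← Real.log_rpow (by linarith)]
  have h1 : (0 : ℝ) < (1 + u) ^ p := Real.rpow_pos_of_pos (by linarith) p
  have h2 := Real.log_le_sub_one_of_pos h1
  have h3 := Real.rpow_add_le_add_rpow (zero_le_one) hu hp.le hp1
  rw [Real.one_rpow] at h3
  linarith

variable {H : Type*} [NormedAddCommGroup H] [InnerProductSpace ℝ H]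

lemma aux_incr (b K : ℝ) (hb0 : 0 < b) (hb1 : b < 1) (hK : 0 ≤ K) (D : ℕ → H)
    (hD : ∀ i k : ℕ, |inner ℝ (D i) (D (i + k))| ≤ K * ((k : ℝ) + 1) ^ (b - 1)) (m : ℕ) :
    b * ‖∑ k ∈ range m, D k‖ ^ 2 ≤ 2 * K * (m * (m : ℝ) ^ b) := by
  induction m with
  | zero => simp
  | succ m ih =>
    rw [sum_range_succ, norm_add_sq_real]
    have h1 : inner ℝ (∑ k ∈ range m, D k) (D m)
        ≤ K * ∑ r ∈ range m, ((r : ℝ) + 1 + 1) ^ (b - 1) := by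
      rw [sum_inner, ← Finset.sum_range_reflect (fun r : ℕ => ((r : ℝ) + 1 + 1) ^ (b - 1)), mul_sum]
      apply sum_le_sum
      intro k hk
      rw [mem_range] at hk
      have := hD k (m - k)
      rw [Nat.add_sub_cancel' hk.le] at this
      refine (le_abs_self _).trans (this.trans_eq ?_)
      have : ((m - 1 - k : ℕ) : ℝ) + 1 = ((m - k : ℕ) : ℝ) := by
        rw [← Nat.cast_add_one]; congr 1; omega
      rw [this]
    have h2 : ‖D m‖ ^ 2 ≤ K := by
      have := (le_abs_self _).trans (hD m 0)
      simpa using this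
    have h3 := aux_sum b hb0 hb1 (m + 1)
    rw [sum_range_succ'] at h3
    push_cast at h3 ⊢
    simp only [zero_add, Real.one_rpow] at h3
    have h4 : (m : ℝ) ^ b ≤ ((m : ℝ) + 1) ^ b :=
      Real.rpow_le_rpow (by positivity) (by linarith) hb0.le
    have h5 := mul_le_mul_of_nonneg_left h3 hK
    have h6 := mul_le_mul_of_nonneg_left h1 hb0.le
    have h7 := mul_le_mul_of_nonneg_left h2 hb0.le
    have h8 : 2 * K * (m * (m : ℝ) ^ b) ≤ 2 * K * (m * ((m : ℝ) + 1) ^ b) := by gcongr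
    nlinarith [mul_nonneg hb0.le hK]

/-- cell interpolation -/
noncomputable def cellI {M : Type*} [AddCommGroup M] [Module ℝ M] (ψ : ℤ → ℤ → M)
    (m n : ℤ) (α β : ℝ) : M :=
  if β ≤ α then
    ψ m n + α • (ψ (m + 1) n - ψ m n) + β • (ψ (m + 1) (n + 1) - ψ (m + 1) n)
  else ψ m n + β • (ψ m (n + 1) - ψ m n) + α • (ψ (m + 1) (n + 1) - ψ m (n + 1))

noncomputable def planeI {M : Type*} [AddCommGroup M] [Module ℝ M] (ψ : ℤ → ℤ → M)
    (x y : ℝ) : M := cellI ψ ⌊x⌋ ⌊y⌋ (Int.fract x) (Int.fract y)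

lemma cellI_eq {M : Type*} [AddCommGroup M] [Module ℝ M] (ψ : ℤ → ℤ → M)
    (m n : ℤ) (α β : ℝ) : cellI ψ m n α β =
      ψ m n + (max α β - β) • (ψ (m + 1) n - ψ m n)
        + (min α β) • (ψ (m + 1) (n + 1) - ψ m (n + 1)) + β • (ψ m (n + 1) - ψ m n) := by
  unfold cellI
  split_ifs with h
  · rw [max_eq_left h, min_eq_right h]; module
  · rw [max_eq_right (not_le.1 h).le, min_eq_left (not_le.1 h).le]; module

lemma cellI_swap {M : Type*} [AddCommGroup M] [Module ℝ M] (ψ : ℤ → ℤ → M)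
    (m n : ℤ) (α β : ℝ) : cellI ψ m n α β = cellI (fun i j => ψ j i) n m β α := by
  unfold cellI
  split_ifs with h h' h'
  · have : α = β := le_antisymm h' h
    subst this; module
  · rfl
  · rfl
  · exact absurd (not_le.1 h) (not_lt.2 (not_le.1 h').le)

lemma aux_max (a a' c : ℝ) : |max a c - max a' c| ≤ |a - a'| :=
  abs_max_sub_max_le_abs _ _ _

lemma aux_min (a a' c : ℝ) : |min a c - min a' c| ≤ |a - a'| := by
  have := abs_min_sub_min_le_max a c a' c
  simpa using this

lemma aux_cell (K : ℝ) (ψ : ℤ → ℤ → H)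
    (h0 : ∀ m n : ℤ, ‖ψ (m + 1) n - ψ m n‖ ^ 2 ≤ K) (m n : ℤ) (α α' β : ℝ) :
    ‖cellI ψ m n α β - cellI ψ m n α' β‖ ^ 2 ≤ 4 * K * |α - α'| ^ 2 := by
  have e : cellI ψ m n α β - cellI ψ m n α' β
      = (max α β - max α' β) • (ψ (m + 1) n - ψ m n)
        + (min α β - min α' β) • (ψ (m + 1) (n + 1) - ψ m (n + 1)) := by
    rw [cellI_eq, cellI_eq]; module
  have hn : ‖cellI ψ m n α β - cellI ψ m n α' β‖ ≤
      |α - α'| * (‖ψ (m + 1) n - ψ m n‖ + ‖ψ (m + 1) (n + 1) - ψ m (n + 1)‖) := by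
    rw [e, mul_add]
    refine (norm_add_le _ _).trans ?_
    rw [norm_smul, norm_smul, Real.norm_eq_abs, Real.norm_eq_abs]
    exact add_le_add (mul_le_mul_of_nonneg_right (aux_max _ _ _) (norm_nonneg _))
      (mul_le_mul_of_nonneg_right (aux_min _ _ _) (norm_nonneg _))
  have := pow_le_pow_left₀ (norm_nonneg _) hn 2
  refine this.trans ?_
  rw [mul_pow, mul_comm]
  gcongr
  nlinarith [h0 m n, h0 m (n + 1), sq_nonneg (‖ψ (m + 1) n - ψ m n‖ - ‖ψ (m + 1) (n + 1) - ψ m (n + 1)‖)]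

lemma cellI_zero {M : Type*} [AddCommGroup M] [Module ℝ M] (ψ : ℤ → ℤ → M)
    (m n : ℤ) (β : ℝ) (hβ : 0 ≤ β) :
    cellI ψ m n 0 β = (1 - β) • ψ m n + β • ψ m (n + 1) := by
  rw [cellI_eq, max_eq_right hβ, min_eq_left hβ]; module

lemma cellI_one {M : Type*} [AddCommGroup M] [Module ℝ M] (ψ : ℤ → ℤ → M)
    (m n : ℤ) (β : ℝ) (hβ : 0 ≤ β) (hβ1 : β ≤ 1) :
    cellI ψ m n 1 β = cellI ψ (m + 1) n 0 β := by
  rw [cellI_zero _ _ _ _ hβ, cellI_eq, max_eq_left hβ1, min_eq_right hβ1]; module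

lemma aux_row (b K : ℝ) (hb0 : 0 < b) (hb1 : b < 1) (hK : 0 ≤ K) (ψ : ℤ → ℤ → H)
    (h0 : ∀ (m n : ℤ) (k : ℕ), |inner ℝ (ψ (m + 1) n - ψ m n) (ψ (m + k + 1) n - ψ (m + k) n)|
      ≤ K * ((k : ℝ) + 1) ^ (b - 1)) (m n : ℤ) (k : ℕ) :
    ‖ψ (m + k) n - ψ m n‖ ^ 2 ≤ 2 * K / b * (k : ℝ) ^ (1 + b) := by
  have h := aux_incr b K hb0 hb1 hK (fun i : ℕ => ψ (m + i + 1) n - ψ (m + i) n) (by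
    intro i k
    have := h0 (m + i) n k
    push_cast
    rwa [← add_assoc]) k
  have e : ∑ i ∈ range k, (ψ (m + i + 1) n - ψ (m + i) n) = ψ (m + k) n - ψ m n := by
    have := Finset.sum_range_sub (fun i : ℕ => ψ (m + i) n) k
    simpa [add_assoc] using this
  rw [e] at h
  have e2 : (k : ℝ) ^ (1 + b) = k * (k : ℝ) ^ b := by
    rw [Real.rpow_add' (by positivity) (by linarith), Real.rpow_one]
  rw [e2, div_mul_eq_mul_div, le_div_iff₀ hb0]
  linarith

lemma aux_three (a c d : H) (X Y Z : ℝ) (ha : ‖a‖ ^ 2 ≤ X) (hc : ‖c‖ ^ 2 ≤ Y) (hd : ‖d‖ ^ 2 ≤ Z) :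
    ‖a + c + d‖ ^ 2 ≤ 3 * (X + Y + Z) := by
  have h := pow_le_pow_left₀ (norm_nonneg _) (norm_add₃_le (a := a) (b := c) (c := d)) 2
  nlinarith [sq_nonneg (‖a‖ - ‖c‖), sq_nonneg (‖a‖ - ‖d‖), sq_nonneg (‖c‖ - ‖d‖)]

lemma aux_sq_le (b r R : ℝ) (hb0 : 0 < b) (hb1 : b < 1) (hr : 0 ≤ r) (hr1 : r ≤ 1) (hR : r ≤ R) :
    r ^ 2 ≤ R ^ (1 + b) := by
  calc r ^ 2 = r ^ (2 : ℝ) := by norm_num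
    _ ≤ r ^ (1 + b) := by
        rcases hr.eq_or_lt with h | h
        · rw [← h, Real.zero_rpow (by norm_num), Real.zero_rpow (by linarith)]
        · exact Real.rpow_le_rpow_of_exponent_ge h hr1 (by linarith)
    _ ≤ _ := Real.rpow_le_rpow hr hR (by linarith)

lemma aux_horiz_le (b K : ℝ) (hb0 : 0 < b) (hb1 : b < 1) (hK : 0 ≤ K) (ψ : ℤ → ℤ → H)
    (h0 : ∀ (m n : ℤ) (k : ℕ), |inner ℝ (ψ (m + 1) n - ψ m n) (ψ (m + k + 1) n - ψ (m + k) n)|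
      ≤ K * ((k : ℝ) + 1) ^ (b - 1)) (x x' y : ℝ) (hx : x ≤ x') :
    ‖planeI ψ x' y - planeI ψ x y‖ ^ 2 ≤ 3 * (8 + 2 / b) * K * (x' - x) ^ (1 + b) := by
  have hd : ∀ m n : ℤ, ‖ψ (m + 1) n - ψ m n‖ ^ 2 ≤ K := by
    intro m n
    have := (le_abs_self _).trans (h0 m n 0)
    simpa using this
  have hβ0 := Int.fract_nonneg y
  have hβ1 := (Int.fract_lt_one y).le
  unfold planeI
  set β := Int.fract y
  set n := ⌊y⌋
  have hf0 := Int.fract_nonneg x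
  have hf1 := Int.fract_lt_one x
  have hf0' := Int.fract_nonneg x'
  have hf1' := Int.fract_lt_one x'
  have ex := Int.floor_add_fract x
  have ex' := Int.floor_add_fract x'
  have hP : 0 ≤ (x' - x) ^ (1 + b) := Real.rpow_nonneg (by linarith) _
  have hKP := mul_nonneg hK hP
  have hb' : 0 ≤ 2 / b := by positivity
  rcases (Int.floor_le_floor hx).eq_or_lt with hm | hm
  · rw [← hm]
    have hm' : (⌊x⌋ : ℝ) = ⌊x'⌋ := by exact_mod_cast hm
    refine (aux_cell K ψ hd _ _ _ _ _).trans ?_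
    have : Int.fract x' - Int.fract x = x' - x := by linarith
    rw [this, abs_of_nonneg (by linarith)]
    have h1 := aux_sq_le b (x' - x) (x' - x) hb0 hb1 (by linarith) (by linarith) le_rfl
    have h2 := mul_le_mul_of_nonneg_left h1 hK
    nlinarith [mul_nonneg hb' hKP]
  · obtain ⟨k, hk⟩ := Int.le.dest (Int.add_one_le_of_lt hm)
    have hkR : (⌊x⌋ : ℝ) + 1 + k = ⌊x'⌋ := by exact_mod_cast hk
    set m := ⌊x⌋
    have A1 := aux_cell K ψ hd m n 1 (Int.fract x) β
    rw [cellI_one _ _ _ _ hβ0 hβ1] at A1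
    have A2 := aux_cell K ψ hd ⌊x'⌋ n (Int.fract x') 0 β
    have A3 : ‖cellI ψ ⌊x'⌋ n 0 β - cellI ψ (m + 1) n 0 β‖ ^ 2 ≤ 2 * K / b * (k : ℝ) ^ (1 + b) := by
      have r1 := aux_row b K hb0 hb1 hK ψ h0 (m + 1) n k
      have r2 := aux_row b K hb0 hb1 hK ψ h0 (m + 1) (n + 1) k
      rw [hk] at r1 r2
      rw [cellI_zero _ _ _ _ hβ0, cellI_zero _ _ _ _ hβ0]
      have e : (1 - β) • ψ ⌊x'⌋ n + β • ψ ⌊x'⌋ (n + 1) - ((1 - β) • ψ (m + 1) n + β • ψ (m + 1) (n + 1))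
        = (1 - β) • (ψ ⌊x'⌋ n - ψ (m + 1) n) + β • (ψ ⌊x'⌋ (n + 1) - ψ (m + 1) (n + 1)) := by module
      rw [e]
      have hn := norm_add_le ((1 - β) • (ψ ⌊x'⌋ n - ψ (m + 1) n)) (β • (ψ ⌊x'⌋ (n + 1) - ψ (m + 1) (n + 1)))
      rw [norm_smul, norm_smul, Real.norm_of_nonneg hβ0, Real.norm_of_nonneg (by linarith : 0 ≤ 1 - β)] at hn
      refine (pow_le_pow_left₀ (norm_nonneg _) hn 2).trans ?_
      set p := ‖ψ ⌊x'⌋ n - ψ (m + 1) n‖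
      set q := ‖ψ ⌊x'⌋ (n + 1) - ψ (m + 1) (n + 1)‖
      have c1 : ((1 - β) * p + β * q) ^ 2 ≤ (1 - β) * p ^ 2 + β * q ^ 2 := by
        nlinarith [mul_nonneg (mul_nonneg hβ0 (by linarith : 0 ≤ 1 - β)) (sq_nonneg (p - q))]
      have c2 := mul_le_mul_of_nonneg_left r1 (by linarith : 0 ≤ 1 - β)
      have c3 := mul_le_mul_of_nonneg_left r2 hβ0
      linarith
    have B1 := aux_sq_le b (1 - Int.fract x) (x' - x) hb0 hb1 (by linarith) (by linarith)
      (by have : (0 : ℝ) ≤ k := by positivity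
          linarith)
    have B2 := aux_sq_le b (Int.fract x') (x' - x) hb0 hb1 hf0' hf1'.le
      (by have : (0 : ℝ) ≤ k := by positivity
          linarith)
    have B3 : (k : ℝ) ^ (1 + b) ≤ (x' - x) ^ (1 + b) :=
      Real.rpow_le_rpow (by positivity) (by linarith) (by linarith)
    rw [sub_zero, sq_abs] at A2
    rw [sq_abs] at A1
    have T := aux_three _ _ _ _ _ _ A2 A3 A1
    have e : cellI ψ ⌊x'⌋ n (Int.fract x') β - cellI ψ ⌊x'⌋ n 0 β
      + (cellI ψ ⌊x'⌋ n 0 β - cellI ψ (m + 1) n 0 β)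
      + (cellI ψ (m + 1) n 0 β - cellI ψ m n (Int.fract x) β)
      = cellI ψ ⌊x'⌋ n (Int.fract x') β - cellI ψ m n (Int.fract x) β := by abel
    rw [e] at T
    refine T.trans ?_
    have C1 := mul_le_mul_of_nonneg_left B1 (by positivity : 0 ≤ 4 * K)
    have C2 := mul_le_mul_of_nonneg_left B2 (by positivity : 0 ≤ 4 * K)
    have C3 := mul_le_mul_of_nonneg_left B3 (by positivity : 0 ≤ 2 * K / b)
    calc _ ≤ 3 * (4 * K * (x' - x) ^ (1 + b) + 2 * K / b * (x' - x) ^ (1 + b)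
            + 4 * K * (x' - x) ^ (1 + b)) := by linarith
      _ = _ := by ring

lemma aux_horiz (b K : ℝ) (hb0 : 0 < b) (hb1 : b < 1) (hK : 0 ≤ K) (ψ : ℤ → ℤ → H)
    (h0 : ∀ (m n : ℤ) (k : ℕ), |inner ℝ (ψ (m + 1) n - ψ m n) (ψ (m + k + 1) n - ψ (m + k) n)|
      ≤ K * ((k : ℝ) + 1) ^ (b - 1)) (x x' y : ℝ) :
    ‖planeI ψ x' y - planeI ψ x y‖ ^ 2 ≤ 3 * (8 + 2 / b) * K * |x' - x| ^ (1 + b) := by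
  rcases le_total x x' with h | h
  · rw [abs_of_nonneg (by linarith)]
    exact aux_horiz_le b K hb0 hb1 hK ψ h0 x x' y h
  · rw [abs_sub_comm, abs_of_nonneg (by linarith), norm_sub_rev]
    exact aux_horiz_le b K hb0 hb1 hK ψ h0 x' x y h

lemma aux_plane (b K : ℝ) (hb0 : 0 < b) (hb1 : b < 1) (hK : 0 ≤ K) (ψ : ℤ → ℤ → H)
    (h0 : ∀ (m n : ℤ) (k : ℕ), |inner ℝ (ψ (m + 1) n - ψ m n) (ψ (m + k + 1) n - ψ (m + k) n)|
      ≤ K * ((k : ℝ) + 1) ^ (b - 1))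
    (h1 : ∀ (m n : ℤ) (k : ℕ), |inner ℝ (ψ n (m + 1) - ψ n m) (ψ n (m + k + 1) - ψ n (m + k))|
      ≤ K * ((k : ℝ) + 1) ^ (b - 1)) (x x' y y' R : ℝ) (hx : |x' - x| ≤ R) (hy : |y' - y| ≤ R) :
    ‖planeI ψ x' y' - planeI ψ x y‖ ^ 2 ≤ 12 * (8 + 2 / b) * K * R ^ (1 + b) := by
  have A := aux_horiz b K hb0 hb1 hK ψ h0 x x' y'
  have B := aux_horiz b K hb0 hb1 hK (fun i j => ψ j i) h1 y y' x
  have sw : ∀ u v : ℝ, planeI (fun i j => ψ j i) u v = planeI ψ v u := by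
    intro u v; unfold planeI; rw [cellI_swap ψ]
  rw [sw, sw] at B
  have hb' : 0 ≤ 3 * (8 + 2 / b) * K := by positivity
  have A' := A.trans (mul_le_mul_of_nonneg_left
    (Real.rpow_le_rpow (abs_nonneg _) hx (by linarith : 0 ≤ 1 + b)) hb')
  have B' := B.trans (mul_le_mul_of_nonneg_left
    (Real.rpow_le_rpow (abs_nonneg _) hy (by linarith : 0 ≤ 1 + b)) hb')
  have e : planeI ψ x' y' - planeI ψ x y =
    (planeI ψ x' y' - planeI ψ x y') + (planeI ψ x y' - planeI ψ x y) := by abel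
  have h := pow_le_pow_left₀ (norm_nonneg _) (norm_add_le (planeI ψ x' y' - planeI ψ x y') (planeI ψ x y' - planeI ψ x y)) 2
  rw [← e] at h
  nlinarith [sq_nonneg (‖planeI ψ x' y' - planeI ψ x y'‖ - ‖planeI ψ x y' - planeI ψ x y‖)]

end Helpers

section Helpers2

variable {Ω : Type} [MeasurableSpace Ω]

lemma aux_inner_toLp (P : Measure Ω) (f g : Ω → ℝ) (hf : MemLp f 2 P) (hg : MemLp g 2 P) :
    inner ℝ (hf.toLp f) (hg.toLp g) = ∫ ω, f ω * g ω ∂P := by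
  rw [L2.inner_def]
  apply integral_congr_ae
  filter_upwards [hf.coeFn_toLp, hg.coeFn_toLp] with ω h1 h2
  rw [h1, h2]
  simp [mul_comm]

lemma aux_cell_toLp (P : Measure Ω) (ψ : ℤ → ℤ → Ω → ℝ) (h : ∀ i j, MemLp (ψ i j) 2 P)
    (m n : ℤ) (α β : ℝ) :
    ∃ hc : MemLp (cellI ψ m n α β) 2 P,
      hc.toLp (cellI ψ m n α β) = cellI (fun i j => (h i j).toLp (ψ i j)) m n α β := by
  unfold cellI
  split_ifs with hab
  · exact ⟨((h m n).add (((h (m + 1) n).sub (h m n)).const_smul α)).add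
      (((h (m + 1) (n + 1)).sub (h (m + 1) n)).const_smul β), rfl⟩
  · exact ⟨((h m n).add (((h m (n + 1)).sub (h m n)).const_smul β)).add
      (((h (m + 1) (n + 1)).sub (h m (n + 1))).const_smul α), rfl⟩

lemma aux_interp (N : ℕ) (φ : (Fin 2 → ℤ) → Ω → ℝ) (t : Fin 2 → ℝ) (ω : Ω) :
    interp2 N φ t ω = ((1 / 4 : ℝ) / N) *
      planeI (fun i j => φ ![i, j]) ((N : ℝ) * t 0) ((N : ℝ) * t 1) ω := by
  have e0 : (fun i => ⌊(N : ℝ) * t i⌋ : Fin 2 → ℤ) = ![⌊(N : ℝ) * t 0⌋, ⌊(N : ℝ) * t 1⌋] := by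
    ext i; fin_cases i <;> rfl
  have u0 : ∀ a c : ℤ, ![a, c] + unitZ2 0 = ![a + 1, c] := by
    intro a c; ext i; fin_cases i <;> simp [unitZ2]
  have u1 : ∀ a c : ℤ, ![a, c] + unitZ2 1 = ![a, c + 1] := by
    intro a c; ext i; fin_cases i <;> simp [unitZ2]
  unfold interp2 planeI cellI
  simp only [e0, u0, u1]
  split_ifs <;> simp

lemma aux_memLp (P : Measure Ω) (φ : (Fin 2 → ℤ) → Ω → ℝ)
    (hG : ∀ c : (Fin 2 → ℤ) →₀ ℝ, ∃ v : NNReal,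
          Measure.map (fun ω => ∑ x ∈ c.support, c x * φ x ω) P = gaussianReal 0 v)
    (x : Fin 2 → ℤ) : MemLp (φ x) 2 P := by
  obtain ⟨v, hv⟩ := hG (Finsupp.single x 1)
  rw [Finsupp.support_single_ne_zero x one_ne_zero] at hv
  simp only [Finset.sum_singleton, Finsupp.single_eq_same, one_mul] at hv
  have hm : AEMeasurable (φ x) P := by
    apply AEMeasurable.of_map_ne_zero
    change Measure.map (fun ω => φ x ω) P ≠ 0
    rw [hv]
    exact IsProbabilityMeasure.ne_zero _
  have h := memLp_id_gaussianReal' (μ := 0) (v := v) 2 (by norm_num)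
  rw [← hv] at h
  have := (memLp_map_measure_iff (f := φ x) (g := id) (by fun_prop) hm).1 h
  simpa using this

lemma aux_kernel (b A : ℝ) (hb0 : 0 < b) (hb1 : b < 1) (hA : 0 < A) (N k : ℕ) :
    A * Real.log (1 + (N : ℝ) ^ 2 / ((k : ℝ) + 1) ^ 2)
      ≤ (2 * A / (1 - b) * (N : ℝ) ^ (1 - b)) * ((k : ℝ) + 1) ^ (b - 1) := by
  have hk : (0 : ℝ) < (k : ℝ) + 1 := by positivity
  have h := aux_log ((1 - b) / 2) ((N : ℝ) ^ 2 / ((k : ℝ) + 1) ^ 2) (by linarith) (by linarith)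
    (by positivity)
  have e : ((N : ℝ) ^ 2 / ((k : ℝ) + 1) ^ 2) ^ ((1 - b) / 2)
      = (N : ℝ) ^ (1 - b) * ((k : ℝ) + 1) ^ (b - 1) := by
    rw [Real.div_rpow (by positivity) (by positivity), ← Real.rpow_natCast, ← Real.rpow_natCast,
      ← Real.rpow_mul (by positivity), ← Real.rpow_mul hk.le, div_eq_mul_inv,
      ← Real.rpow_neg hk.le]
    congr 2 <;> (push_cast; ring)
  rw [e] at h
  have h' := mul_le_mul_of_nonneg_left h hA.le
  refine h'.trans_eq ?_
  have : 1 - b ≠ 0 := by linarith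
  field_simp

end Helpers2

/-- Second-moment increment bound for the interpolated membrane model in
`d = 2`: fix `b ∈ (0,1)` and `A > 0`; there is `C > 0` depending only on `b, A` such that
for every `N ≥ 2` and every centered Gaussian field on `ℤ²` vanishing outside
`V_{N-1} = [-(N-1), N-1]²` whose covariance has second mixed differences bounded by
`A log(1 + N²/(‖x-y‖+1)²)`, the interpolation `Ψ_N` satisfies
`E[(Ψ_N(t) - Ψ_N(s))²] ≤ C ‖t-s‖^{1+b}` on `[-1,1]²`. -/
theorem statement9 (b A : ℝ) (hb : b ∈ Set.Ioo (0 : ℝ) 1) (hA : 0 < A) :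
    ∃ C : ℝ, 0 < C ∧ ∀ N : ℕ, 2 ≤ N →
      ∀ (Ω : Type) [MeasurableSpace Ω] (P : Measure Ω), IsProbabilityMeasure P →
      ∀ φ : (Fin 2 → ℤ) → Ω → ℝ,
        (∀ c : (Fin 2 → ℤ) →₀ ℝ, ∃ v : NNReal,
          Measure.map (fun ω => ∑ x ∈ c.support, c x * φ x ω) P = gaussianReal 0 v) →
        (∀ x : Fin 2 → ℤ, ¬ (∀ i, |x i| ≤ (N : ℤ) - 1) → ∀ᵐ ω ∂P, φ x ω = 0) →
        (∀ (x y : Fin 2 → ℤ) (i j : Fin 2),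
          |covG2 P φ (x + unitZ2 i) (y + unitZ2 j) - covG2 P φ (x + unitZ2 i) y -
              covG2 P φ x (y + unitZ2 j) + covG2 P φ x y|
            ≤ A * Real.log (1 + (N : ℝ) ^ 2 / (znorm2 (x - y) + 1) ^ 2)) →
        ∀ s t : Fin 2 → ℝ, (∀ i, |s i| ≤ 1) → (∀ i, |t i| ≤ 1) →
          (∫ ω, (interp2 N φ t ω - interp2 N φ s ω) ^ 2 ∂P)
            ≤ C * rnorm2 (t - s) ^ (1 + b) := by
  obtain ⟨hb0, hb1⟩ := hb
  have h1b : 0 < 1 - b := by linarith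
  refine ⟨12 * (8 + 2 / b) * (2 * A / (1 - b)) / 16, by positivity, ?_⟩
  intro N hN Ω _ P hP φ hG _ hcov s t _ _
  have hNpos : (0 : ℝ) < N := by
    have : 0 < N := by omega
    exact_mod_cast this
  have hmem := aux_memLp P φ hG
  have u0 : ∀ a c : ℤ, ![a, c] + unitZ2 0 = ![a + 1, c] := by
    intro a c; ext i; fin_cases i <;> simp [unitZ2]
  have u1 : ∀ a c : ℤ, ![a, c] + unitZ2 1 = ![a, c + 1] := by
    intro a c; ext i; fin_cases i <;> simp [unitZ2]
  have hin : ∀ (x y : Fin 2 → ℤ) (i : Fin 2),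
      inner ℝ ((hmem (x + unitZ2 i)).toLp (φ (x + unitZ2 i)) - (hmem x).toLp (φ x))
        ((hmem (y + unitZ2 i)).toLp (φ (y + unitZ2 i)) - (hmem y).toLp (φ y))
      = covG2 P φ (x + unitZ2 i) (y + unitZ2 i) - covG2 P φ (x + unitZ2 i) y -
              covG2 P φ x (y + unitZ2 i) + covG2 P φ x y := by
    intro x y i
    rw [inner_sub_left, inner_sub_right, inner_sub_right]
    simp only [aux_inner_toLp]
    unfold covG2
    ring
  set K : ℝ := 2 * A / (1 - b) * (N : ℝ) ^ (1 - b) with hKdef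
  have hK : 0 ≤ K := by positivity
  let ψ : ℤ → ℤ → Ω → ℝ := fun i j => φ ![i, j]
  have hψ : ∀ i j, MemLp (ψ i j) 2 P := fun i j => hmem _
  have H0 : ∀ (m n : ℤ) (k : ℕ), |inner ℝ ((hψ (m + 1) n).toLp - (hψ m n).toLp)
      ((hψ (m + k + 1) n).toLp - (hψ (m + k) n).toLp)| ≤ K * ((k : ℝ) + 1) ^ (b - 1) := by
    intro m n k
    have h := hcov ![m, n] ![m + k, n] 0 0
    rw [← hin] at h
    have hz : znorm2 (![m, n] - ![m + k, n]) = k := by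
      simp [znorm2]
    rw [hz] at h
    simp only [u0] at h
    exact h.trans (aux_kernel b A hb0 hb1 hA N k)
  have H1 : ∀ (m n : ℤ) (k : ℕ), |inner ℝ ((hψ n (m + 1)).toLp - (hψ n m).toLp)
      ((hψ n (m + k + 1)).toLp - (hψ n (m + k)).toLp)| ≤ K * ((k : ℝ) + 1) ^ (b - 1) := by
    intro m n k
    have h := hcov ![n, m] ![n, m + k] 1 1
    rw [← hin] at h
    have hz : znorm2 (![n, m] - ![n, m + k]) = k := by
      simp [znorm2]
    rw [hz] at h
    simp only [u1] at h
    exact h.trans (aux_kernel b A hb0 hb1 hA N k)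
  have hr : ∀ i, |(N : ℝ) * t i - N * s i| ≤ N * rnorm2 (t - s) := by
    intro i
    rw [← mul_sub, abs_mul, abs_of_pos hNpos]
    refine mul_le_mul_of_nonneg_left ?_ hNpos.le
    unfold rnorm2
    apply Real.abs_le_sqrt
    exact Finset.single_le_sum (f := fun i => ((t - s) i) ^ 2)
      (fun j _ => sq_nonneg _) (Finset.mem_univ i)
  have M := aux_plane b K hb0 hb1 hK (fun i j => (hψ i j).toLp) H0 H1 _ _ _ _ _ (hr 0) (hr 1)
  have hR : 0 ≤ rnorm2 (t - s) := Real.sqrt_nonneg _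
  obtain ⟨ct, et⟩ := aux_cell_toLp P ψ hψ ⌊(N : ℝ) * t 0⌋ ⌊(N : ℝ) * t 1⌋
    (Int.fract ((N : ℝ) * t 0)) (Int.fract ((N : ℝ) * t 1))
  obtain ⟨cs, es⟩ := aux_cell_toLp P ψ hψ ⌊(N : ℝ) * s 0⌋ ⌊(N : ℝ) * s 1⌋
    (Int.fract ((N : ℝ) * s 0)) (Int.fract ((N : ℝ) * s 1))
  unfold planeI at M
  rw [← et, ← es, ← MemLp.toLp_sub, ← real_inner_self_eq_norm_sq, aux_inner_toLp] at M
  have e : ∀ ω, (interp2 N φ t ω - interp2 N φ s ω) ^ 2 = ((1 / 4 : ℝ) / N) ^ 2 *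
      ((planeI ψ ((N : ℝ) * t 0) ((N : ℝ) * t 1) - planeI ψ ((N : ℝ) * s 0) ((N : ℝ) * s 1)) ω
      * (planeI ψ ((N : ℝ) * t 0) ((N : ℝ) * t 1) - planeI ψ ((N : ℝ) * s 0) ((N : ℝ) * s 1)) ω) := by
    intro ω
    rw [aux_interp, aux_interp, Pi.sub_apply]
    ring
  simp_rw [e]
  rw [integral_const_mul]
  refine (mul_le_mul_of_nonneg_left M (sq_nonneg _)).trans_eq ?_
  rw [Real.mul_rpow hNpos.le hR, hKdef]
  have e3 : (N : ℝ) ^ (1 - b) * (N : ℝ) ^ (1 + b) = (N : ℝ) ^ 2 := by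
    rw [← Real.rpow_add hNpos, ← Real.rpow_natCast]
    congr 1; push_cast; ring
  calc _ = ((1 / 4 : ℝ) / N) ^ 2 * (12 * (8 + 2 / b) * (2 * A / (1 - b))) *
        ((N : ℝ) ^ (1 - b) * (N : ℝ) ^ (1 + b)) * rnorm2 (t - s) ^ (1 + b) := by ring
    _ = _ := by
      rw [e3]
      field_simp
      ring
end

section
/- Fix A > 0. There exists a constant C > 0 depending only on A such that the following holds for every integer N ≥ 2. Let (φ_x)_{x ∈ ℤ³} be a centered Gaussian field with φ_x = 0 almost surely for x ∉ V_{N−1}, whose covariance G(x,y) = E[φ_x φ_y] satisfies, for all x, y ∈ ℤ³ and all i, j ∈ {1,2,3}, both |G(x+e_i, y) − G(x, y)| ≤ A and |G(x+e_i, y+e_j) − G(x+e_i, y) − G(x, y+e_j) + G(x, y)| ≤ A. Let Ψ_N be the piecewise affine interpolation of the rescaled field defined below. Then E[(Ψ_N(t) − Ψ_N(s))²] ≤ C ‖t − s‖ for all s, t ∈ [−1,1]³. -/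
open MeasureTheory ProbabilityTheory
open scoped BigOperators

/-- The `i`-th standard basis vector of `ℤ³`. -/
def unitZ3 (i : Fin 3) : Fin 3 → ℤ := fun j => if j = i then 1 else 0

/-- Euclidean norm on `ℝ³`. -/
noncomputable def rnorm3 (t : Fin 3 → ℝ) : ℝ := Real.sqrt (∑ i, (t i) ^ 2)

/-- The covariance `G(x,y) = E[φ_x φ_y]`. -/
noncomputable def covG3 {Ω : Type} [MeasurableSpace Ω] (P : Measure Ω)
    (φ : (Fin 3 → ℤ) → Ω → ℝ) (x y : Fin 3 → ℤ) : ℝ :=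
  ∫ ω, φ x ω * φ y ω ∂P

/-- The piecewise affine interpolation `Ψ_N` (with `κ = 1/6`) of the rescaled field
`(κ/√N) φ` on `[-1,1]³`, interpolating over the tetrahedra determined by the ordering of
the fractional parts of `N t`. -/
noncomputable def interp3 {Ω : Type} (N : ℕ) (φ : (Fin 3 → ℤ) → Ω → ℝ)
    (t : Fin 3 → ℝ) (ω : Ω) : ℝ :=
  let a : Fin 3 → ℤ := fun i => ⌊(N : ℝ) * t i⌋
  let fr : Fin 3 → ℝ := fun i => Int.fract ((N : ℝ) * t i)
  let term : Fin 3 → Fin 3 → Fin 3 → ℝ := fun i j k =>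
    φ a ω + fr i * (φ (a + unitZ3 i) ω - φ a ω) +
      fr j * (φ (a + unitZ3 i + unitZ3 j) ω - φ (a + unitZ3 i) ω) +
      fr k * (φ (a + unitZ3 i + unitZ3 j + unitZ3 k) ω - φ (a + unitZ3 i + unitZ3 j) ω)
  ((1 / 6 : ℝ) / Real.sqrt N) *
    (if fr 1 ≤ fr 0 then
      (if fr 2 ≤ fr 1 then term 0 1 2
       else if fr 2 ≤ fr 0 then term 0 2 1
       else term 2 0 1)
    else
      (if fr 2 ≤ fr 0 then term 1 0 2
       else if fr 2 ≤ fr 1 then term 1 2 0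
       else term 2 1 0))

/-- The uniform measure on `[0,1)`. -/
noncomputable def mu01 : Measure ℝ := volume.restrict (Set.Ico (0:ℝ) 1)

instance mu01_fin : IsFiniteMeasure mu01 := by
  unfold mu01; infer_instance

noncomputable def stepf (r θ : ℝ) : ℝ := (Set.Ici (1 - r)).indicator (fun _ => (1:ℝ)) θ

lemma stepf_integrable (r : ℝ) : Integrable (stepf r) mu01 :=
  (integrable_const (1:ℝ)).indicator measurableSet_Ici

lemma stepf_integral (r : ℝ) (h0 : 0 ≤ r) (h1 : r < 1) : ∫ θ, stepf r θ ∂mu01 = r := by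
  unfold stepf mu01
  rw [integral_indicator measurableSet_Ici, Measure.restrict_restrict measurableSet_Ici]
  have : Set.Ici (1 - r) ∩ Set.Ico (0:ℝ) 1 = Set.Ico (1 - r) 1 := by
    ext x; simp only [Set.mem_inter_iff, Set.mem_Ici, Set.mem_Ico]
    constructor
    · rintro ⟨a, b, c⟩; exact ⟨a, c⟩
    · rintro ⟨a, c⟩; exact ⟨a, by linarith, c⟩
  rw [this]
  simp [h0]

lemma floor_step (x θ : ℝ) (h0 : 0 ≤ θ) (h1 : θ < 1) :
    ⌊x + θ⌋ = ⌊x⌋ + (if 1 - Int.fract x ≤ θ then 1 else 0) := by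
  have hx := Int.floor_add_fract x
  have hf0 := Int.fract_nonneg x
  have hf1 := Int.fract_lt_one x
  rw [Int.floor_eq_iff]
  split_ifs with h
  · push_cast; constructor <;> linarith
  · push_cast; constructor <;> linarith

lemma ae_mu01 {p : ℝ → Prop} (h : ∀ θ, 0 ≤ θ → θ < 1 → p θ) : ∀ᵐ θ ∂mu01, p θ := by
  unfold mu01
  rw [ae_restrict_iff' measurableSet_Ico]
  exact Filter.Eventually.of_forall fun θ hθ => h θ hθ.1 hθ.2

lemma floor_int (x : ℝ) : Integrable (fun θ => (⌊x + θ⌋ : ℝ)) mu01 ∧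
    ∫ θ, (⌊x + θ⌋ : ℝ) ∂mu01 = x := by
  have e : (fun θ => (⌊x + θ⌋ : ℝ)) =ᵐ[mu01] fun θ => (⌊x⌋ : ℝ) + stepf (Int.fract x) θ := by
    apply ae_mu01
    intro θ h0 h1
    beta_reduce
    rw [floor_step x θ h0 h1]
    by_cases h : 1 - Int.fract x ≤ θ
    · simp [stepf, h]
    · simp [stepf, h]
  refine ⟨((integrable_const _).add (stepf_integrable _)).congr e.symm, ?_⟩
  rw [integral_congr_ae e, integral_add (integrable_const _) (stepf_integrable _),
    stepf_integral _ (Int.fract_nonneg x) (Int.fract_lt_one x)]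
  simp [mu01, Measure.real]

lemma floor_abs (x y : ℝ) : Integrable (fun θ => |(⌊x + θ⌋ : ℝ) - ⌊y + θ⌋|) mu01 ∧
    ∫ θ, |(⌊x + θ⌋ : ℝ) - ⌊y + θ⌋| ∂mu01 = |x - y| := by
  refine ⟨((floor_int x).1.sub (floor_int y).1).abs, ?_⟩
  rcases le_total x y with h | h
  · have : ∀ θ, |(⌊x + θ⌋ : ℝ) - ⌊y + θ⌋| = (⌊y + θ⌋ : ℝ) - ⌊x + θ⌋ := by
      intro θ
      have : (⌊x + θ⌋ : ℝ) ≤ ⌊y + θ⌋ := by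
        exact_mod_cast Int.floor_le_floor (by linarith)
      rw [abs_of_nonpos (by linarith)]; ring
    simp_rw [this]
    rw [integral_sub (floor_int y).1 (floor_int x).1, (floor_int y).2, (floor_int x).2,
      abs_of_nonpos (by linarith)]; ring
  · have : ∀ θ, |(⌊x + θ⌋ : ℝ) - ⌊y + θ⌋| = (⌊x + θ⌋ : ℝ) - ⌊y + θ⌋ := by
      intro θ
      have : (⌊y + θ⌋ : ℝ) ≤ ⌊x + θ⌋ := by
        exact_mod_cast Int.floor_le_floor (by linarith)
      rw [abs_of_nonneg (by linarith)]
    simp_rw [this]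
    rw [integral_sub (floor_int x).1 (floor_int y).1, (floor_int y).2, (floor_int x).2,
      abs_of_nonneg (by linarith)]

/-- one tetrahedron term -/
noncomputable def term3 (u : Fin 3 → ℝ) (f : (Fin 3 → ℤ) → ℝ) (i j k : Fin 3) : ℝ :=
  let a : Fin 3 → ℤ := fun i => ⌊u i⌋
  let fr : Fin 3 → ℝ := fun i => Int.fract (u i)
  f a + fr i * (f (a + unitZ3 i) - f a) +
      fr j * (f (a + unitZ3 i + unitZ3 j) - f (a + unitZ3 i)) +
      fr k * (f (a + unitZ3 i + unitZ3 j + unitZ3 k) - f (a + unitZ3 i + unitZ3 j))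

noncomputable def I3 (u : Fin 3 → ℝ) (f : (Fin 3 → ℤ) → ℝ) : ℝ :=
  let fr : Fin 3 → ℝ := fun i => Int.fract (u i)
  (if fr 1 ≤ fr 0 then
      (if fr 2 ≤ fr 1 then term3 u f 0 1 2
       else if fr 2 ≤ fr 0 then term3 u f 0 2 1
       else term3 u f 2 0 1)
    else
      (if fr 2 ≤ fr 0 then term3 u f 1 0 2
       else if fr 2 ≤ fr 1 then term3 u f 1 2 0
       else term3 u f 2 1 0))

lemma interp3_eq {Ω : Type} (N : ℕ) (φ : (Fin 3 → ℤ) → Ω → ℝ) (t : Fin 3 → ℝ) (ω : Ω) :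
    interp3 N φ t ω = ((1 / 6 : ℝ) / Real.sqrt N) *
      I3 (fun i => (N : ℝ) * t i) (fun x => φ x ω) := rfl

lemma I3_cases (u : Fin 3 → ℝ) : ∃ i j k : Fin 3, i ≠ j ∧ i ≠ k ∧ j ≠ k ∧
    (∀ m, m = i ∨ m = j ∨ m = k) ∧
    Int.fract (u j) ≤ Int.fract (u i) ∧ Int.fract (u k) ≤ Int.fract (u j) ∧
    ∀ f, I3 u f = term3 u f i j k := by
  by_cases h1 : Int.fract (u 1) ≤ Int.fract (u 0)
  · by_cases h2 : Int.fract (u 2) ≤ Int.fract (u 1)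
    · exact ⟨0, 1, 2, by decide, by decide, by decide, by decide, h1, h2,
        fun f => by simp [I3, h1, h2]⟩
    · by_cases h3 : Int.fract (u 2) ≤ Int.fract (u 0)
      · exact ⟨0, 2, 1, by decide, by decide, by decide, by decide, h3, by linarith,
          fun f => by simp [I3, h1, h2, h3]⟩
      · exact ⟨2, 0, 1, by decide, by decide, by decide, by decide, by linarith, h1,
          fun f => by simp [I3, h1, h2, h3]⟩
  · by_cases h2 : Int.fract (u 2) ≤ Int.fract (u 0)
    · exact ⟨1, 0, 2, by decide, by decide, by decide, by decide, by linarith, h2,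
        fun f => by simp [I3, h1, h2]⟩
    · by_cases h3 : Int.fract (u 2) ≤ Int.fract (u 1)
      · exact ⟨1, 2, 0, by decide, by decide, by decide, by decide, h3, by linarith,
          fun f => by simp [I3, h1, h2, h3]⟩
      · exact ⟨2, 1, 0, by decide, by decide, by decide, by decide, by linarith, by linarith,
          fun f => by simp [I3, h1, h2, h3]⟩

lemma I3_lin (u : Fin 3 → ℝ) : ∃ (w : Fin 4 → ℝ) (x : Fin 4 → (Fin 3 → ℤ)),
    ∀ f, I3 u f = ∑ m, w m * f (x m) := by
  obtain ⟨i, j, k, -, -, -, -, -, -, h⟩ := I3_cases u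
  refine ⟨![1 - Int.fract (u i), Int.fract (u i) - Int.fract (u j),
    Int.fract (u j) - Int.fract (u k), Int.fract (u k)],
    ![fun i => ⌊u i⌋, (fun i => ⌊u i⌋) + unitZ3 i, (fun i => ⌊u i⌋) + unitZ3 i + unitZ3 j,
      (fun i => ⌊u i⌋) + unitZ3 i + unitZ3 j + unitZ3 k], fun f => ?_⟩
  rw [h, Fin.sum_univ_four]
  simp [term3]
  ring

lemma I3_int (u : Fin 3 → ℝ) (f : (Fin 3 → ℤ) → ℝ) :
    Integrable (fun θ : ℝ => f (fun i => ⌊u i + θ⌋)) mu01 ∧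
    ∫ θ, f (fun i => ⌊u i + θ⌋) ∂mu01 = I3 u f := by
  obtain ⟨i, j, k, hij, hik, hjk, hall, h1, h2, h⟩ := I3_cases u
  rw [h]
  set a : Fin 3 → ℤ := fun i => ⌊u i⌋ with ha
  have e : (fun θ : ℝ => f (fun i => ⌊u i + θ⌋)) =ᵐ[mu01] fun θ => f a +
      stepf (Int.fract (u i)) θ * (f (a + unitZ3 i) - f a) +
      stepf (Int.fract (u j)) θ * (f (a + unitZ3 i + unitZ3 j) - f (a + unitZ3 i)) +
      stepf (Int.fract (u k)) θ *
        (f (a + unitZ3 i + unitZ3 j + unitZ3 k) - f (a + unitZ3 i + unitZ3 j)) := by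
    apply ae_mu01
    intro θ h0 hθ
    have hfl : (fun m => ⌊u m + θ⌋) =
        fun m => a m + (if 1 - Int.fract (u m) ≤ θ then 1 else 0) := by
      funext m; exact floor_step _ _ h0 hθ
    beta_reduce
    rw [hfl]
    by_cases hi : 1 - Int.fract (u i) ≤ θ
    · by_cases hj : 1 - Int.fract (u j) ≤ θ
      · by_cases hk : 1 - Int.fract (u k) ≤ θ
        · have : (fun m => a m + (if 1 - Int.fract (u m) ≤ θ then 1 else 0)) =
              a + unitZ3 i + unitZ3 j + unitZ3 k := by
            funext m
            rcases hall m with rfl | rfl | rfl <;>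
              simp [unitZ3, *, Ne.symm hij, Ne.symm hik, Ne.symm hjk]
          rw [this]; simp [stepf, hi, hj, hk]
        · have : (fun m => a m + (if 1 - Int.fract (u m) ≤ θ then 1 else 0)) =
              a + unitZ3 i + unitZ3 j := by
            funext m
            rcases hall m with rfl | rfl | rfl <;>
              simp [unitZ3, *, Ne.symm hij, Ne.symm hik, Ne.symm hjk]
          rw [this]; simp [stepf, hi, hj, hk]
      · have hk : ¬ (1 - Int.fract (u k) ≤ θ) := by linarith
        have : (fun m => a m + (if 1 - Int.fract (u m) ≤ θ then 1 else 0)) =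
              a + unitZ3 i := by
            funext m
            rcases hall m with rfl | rfl | rfl <;>
              simp [unitZ3, *, Ne.symm hij, Ne.symm hik, Ne.symm hjk]
        rw [this]; simp [stepf, hi, hj, hk]
    · have hj : ¬ (1 - Int.fract (u j) ≤ θ) := by linarith
      have hk : ¬ (1 - Int.fract (u k) ≤ θ) := by linarith
      have : (fun m => a m + (if 1 - Int.fract (u m) ≤ θ then 1 else 0)) = a := by
            funext m
            rcases hall m with rfl | rfl | rfl <;> simp [*]
      rw [this]; simp [stepf, hi, hj, hk]
  have i0 : Integrable (fun _ : ℝ => f a) mu01 := integrable_const _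
  have i1 := (stepf_integrable (Int.fract (u i))).mul_const (f (a + unitZ3 i) - f a)
  have i2 := (stepf_integrable (Int.fract (u j))).mul_const
    (f (a + unitZ3 i + unitZ3 j) - f (a + unitZ3 i))
  have i3 := (stepf_integrable (Int.fract (u k))).mul_const
    (f (a + unitZ3 i + unitZ3 j + unitZ3 k) - f (a + unitZ3 i + unitZ3 j))
  have i01 : Integrable (fun θ : ℝ => f a +
      stepf (Int.fract (u i)) θ * (f (a + unitZ3 i) - f a)) mu01 := i0.add i1
  have i012 : Integrable (fun θ : ℝ => f a +
      stepf (Int.fract (u i)) θ * (f (a + unitZ3 i) - f a) +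
      stepf (Int.fract (u j)) θ * (f (a + unitZ3 i + unitZ3 j) - f (a + unitZ3 i))) mu01 :=
    i01.add i2
  refine ⟨(i012.add i3).congr e.symm, ?_⟩
  rw [integral_congr_ae e, integral_add i012 i3, integral_add i01 i2,
    integral_add i0 i1]
  simp only [integral_mul_const]
  rw [stepf_integral _ (Int.fract_nonneg _) (Int.fract_lt_one _),
    stepf_integral _ (Int.fract_nonneg _) (Int.fract_lt_one _),
    stepf_integral _ (Int.fract_nonneg _) (Int.fract_lt_one _)]
  simp [mu01, Measure.real, term3, ha]

lemma line_lip (A : ℝ) (f : (Fin 3 → ℤ) → ℝ)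
    (hf : ∀ x i, |f (x + unitZ3 i) - f x| ≤ A) (x : Fin 3 → ℤ) (i : Fin 3) (n : ℤ) :
    |f (x + n • unitZ3 i) - f x| ≤ A * |(n : ℝ)| := by
  have nat : ∀ (n : ℕ) (x : Fin 3 → ℤ), |f (x + n • unitZ3 i) - f x| ≤ A * n := by
    intro n
    induction n with
    | zero => intro x; simp
    | succ n ih =>
      intro x
      have h1 := ih x
      have h2 := hf (x + n • unitZ3 i) i
      rw [succ_nsmul, ← add_assoc]
      push_cast
      have := abs_sub_le (f (x + n • unitZ3 i + unitZ3 i)) (f (x + n • unitZ3 i)) (f x)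
      linarith
  rcases Int.eq_nat_or_neg n with ⟨m, rfl | rfl⟩
  · simpa using nat m x
  · have := nat m (x + (-(m:ℤ)) • unitZ3 i)
    rw [abs_sub_comm]
    simpa using this

lemma lat_lip (A : ℝ) (f : (Fin 3 → ℤ) → ℝ)
    (hf : ∀ x i, |f (x + unitZ3 i) - f x| ≤ A) (x y : Fin 3 → ℤ) :
    |f x - f y| ≤ A * ∑ i, |(x i : ℝ) - y i| := by
  have h0 := line_lip A f hf y 0 (x 0 - y 0)
  have h1 := line_lip A f hf (y + (x 0 - y 0) • unitZ3 0) 1 (x 1 - y 1)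
  have h2 := line_lip A f hf (y + (x 0 - y 0) • unitZ3 0 + (x 1 - y 1) • unitZ3 1) 2 (x 2 - y 2)
  have e : y + (x 0 - y 0) • unitZ3 0 + (x 1 - y 1) • unitZ3 1 + (x 2 - y 2) • unitZ3 2 = x := by
    funext m; fin_cases m <;> simp [unitZ3]
  rw [e] at h2
  push_cast at h0 h1 h2
  rw [Fin.sum_univ_three]
  rw [abs_le] at *
  constructor <;> linarith [h0.1, h0.2, h1.1, h1.2, h2.1, h2.2]

lemma I3_lip (A : ℝ) (f : (Fin 3 → ℤ) → ℝ)
    (hf : ∀ x i, |f (x + unitZ3 i) - f x| ≤ A) (u v : Fin 3 → ℝ) :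
    |I3 u f - I3 v f| ≤ A * ∑ i, |u i - v i| := by
  rw [← (I3_int u f).2, ← (I3_int v f).2, ← integral_sub (I3_int u f).1 (I3_int v f).1]
  refine (abs_integral_le_integral_abs).trans ?_
  have hi : ∀ i ∈ (Finset.univ : Finset (Fin 3)),
      Integrable (fun θ => |(⌊u i + θ⌋ : ℝ) - ⌊v i + θ⌋|) mu01 := fun i _ => (floor_abs _ _).1
  have : A * ∑ i, |u i - v i| = ∫ θ, A * ∑ i, |(⌊u i + θ⌋ : ℝ) - ⌊v i + θ⌋| ∂mu01 := by
    rw [integral_const_mul, integral_finsetSum _ hi]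
    simp only [(floor_abs _ _).2]
  rw [this]
  apply integral_mono ((I3_int u f).1.sub (I3_int v f).1).abs
    ((integrable_finsetSum _ hi).const_mul A)
  intro θ
  exact lat_lip A f hf _ _

lemma I3_bdd (B : ℝ) (f : (Fin 3 → ℤ) → ℝ) (hf : ∀ x, |f x| ≤ B) (u : Fin 3 → ℝ) :
    |I3 u f| ≤ B := by
  rw [← (I3_int u f).2]
  refine (abs_integral_le_integral_abs).trans ?_
  refine (integral_mono (I3_int u f).1.abs (integrable_const B) (fun θ => hf _)).trans ?_
  simp [mu01, Measure.real]

lemma I3_swap {Ω : Type} [MeasurableSpace Ω] (P : Measure Ω) (F : (Fin 3 → ℤ) → Ω → ℝ)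
    (hF : ∀ x, Integrable (F x) P) (u : Fin 3 → ℝ) :
    Integrable (fun ω => I3 u (fun x => F x ω)) P ∧
    ∫ ω, I3 u (fun x => F x ω) ∂P = I3 u (fun x => ∫ ω, F x ω ∂P) := by
  obtain ⟨w, x, h⟩ := I3_lin u
  simp only [h]
  have hi : ∀ m ∈ (Finset.univ : Finset (Fin 4)),
      Integrable (fun ω => w m * F (x m) ω) P := fun m _ => (hF _).const_mul _
  refine ⟨integrable_finsetSum _ hi, ?_⟩
  rw [integral_finsetSum _ hi]
  simp only [integral_const_mul]

lemma I3_mul (u : Fin 3 → ℝ) (f : (Fin 3 → ℤ) → ℝ) (c : ℝ) :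
    I3 u f * c = I3 u (fun x => f x * c) := by
  obtain ⟨w, x, h⟩ := I3_lin u
  simp only [h, Finset.sum_mul, mul_assoc]

lemma main3 {Ω : Type} [MeasurableSpace Ω] (P : Measure Ω) (φ : (Fin 3 → ℤ) → Ω → ℝ)
    (hφ : ∀ x, MemLp (φ x) 2 P) (A : ℝ)
    (hG : ∀ (x y : Fin 3 → ℤ) (i : Fin 3),
          |covG3 P φ (x + unitZ3 i) y - covG3 P φ x y| ≤ A) (u v : Fin 3 → ℝ) :
    ∫ ω, (I3 u (fun x => φ x ω) - I3 v (fun x => φ x ω)) ^ 2 ∂P ≤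
      2 * (A * ∑ i, |u i - v i|) := by
  have hI : ∀ x y, Integrable (fun ω => φ x ω * φ y ω) P := fun x y =>
    (hφ x).integrable_mul (hφ y)
  let D : Ω → ℝ := fun ω => I3 u (fun x => φ x ω) - I3 v (fun x => φ x ω)
  have hD : ∀ y ω, φ y ω * D ω =
      I3 u (fun x => φ x ω * φ y ω) - I3 v (fun x => φ x ω * φ y ω) := by
    intro y ω
    rw [← I3_mul, ← I3_mul]; simp only [D]; ring
  have hDi : ∀ y, Integrable (fun ω => φ y ω * D ω) P := by
    intro y
    simp only [hD]
    exact (I3_swap P (fun x ω => φ x ω * φ y ω) (fun x => hI x y) u).1.sub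
      (I3_swap P (fun x ω => φ x ω * φ y ω) (fun x => hI x y) v).1
  have hb : ∀ y, |∫ ω, φ y ω * D ω ∂P| ≤ A * ∑ i, |u i - v i| := by
    intro y
    simp only [hD]
    rw [integral_sub (I3_swap P (fun x ω => φ x ω * φ y ω) (fun x => hI x y) u).1
      (I3_swap P (fun x ω => φ x ω * φ y ω) (fun x => hI x y) v).1,
      (I3_swap P (fun x ω => φ x ω * φ y ω) (fun x => hI x y) u).2,
      (I3_swap P (fun x ω => φ x ω * φ y ω) (fun x => hI x y) v).2]
    exact I3_lip A (fun x => covG3 P φ x y) (fun x i => hG x y i) u v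
  have hsq : ∀ ω, (I3 u (fun x => φ x ω) - I3 v (fun x => φ x ω)) ^ 2 =
      I3 u (fun y => φ y ω * D ω) - I3 v (fun y => φ y ω * D ω) := by
    intro ω
    rw [← I3_mul, ← I3_mul]; simp only [D]; ring
  simp only [hsq]
  have su := I3_swap P (fun y ω => φ y ω * D ω) hDi u
  have sv := I3_swap P (fun y ω => φ y ω * D ω) hDi v
  rw [integral_sub su.1 sv.1, su.2, sv.2]
  have bu := abs_le.1 (I3_bdd _ _ hb u)
  have bv := abs_le.1 (I3_bdd _ _ hb v)
  linarith [bu.2, bv.1]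

lemma gauss_memLp {Ω : Type} [MeasurableSpace Ω] (P : Measure Ω)
    (φ : (Fin 3 → ℤ) → Ω → ℝ)
    (h : ∀ c : (Fin 3 → ℤ) →₀ ℝ, ∃ v : NNReal,
          Measure.map (fun ω => ∑ x ∈ c.support, c x * φ x ω) P = gaussianReal 0 v)
    (x : Fin 3 → ℤ) : MemLp (φ x) 2 P := by
  obtain ⟨v, hv⟩ := h (Finsupp.single x 1)
  have e : (fun ω => ∑ y ∈ (Finsupp.single x (1:ℝ)).support,
      (Finsupp.single x (1:ℝ)) y * φ y ω) = φ x := by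
    funext ω
    rw [Finsupp.support_single_ne_zero x one_ne_zero]
    simp
  rw [e] at hv
  have hm : AEMeasurable (φ x) P := by
    by_contra hc
    rw [Measure.map_of_not_aemeasurable hc] at hv
    exact (IsProbabilityMeasure.ne_zero (gaussianReal 0 v)) hv.symm
  have h2 : MemLp (id : ℝ → ℝ) 2 (Measure.map (φ x) P) := by
    rw [hv]; exact_mod_cast memLp_id_gaussianReal (μ := 0) (v := v) 2
  exact (memLp_map_measure_iff h2.1 hm).1 h2

lemma l1_le (t : Fin 3 → ℝ) : ∑ i, |t i| ≤ 3 * rnorm3 t := by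
  have : ∀ i, |t i| ≤ rnorm3 t := by
    intro i
    apply Real.abs_le_sqrt
    exact Finset.single_le_sum (f := fun i => (t i)^2) (fun i _ => sq_nonneg _) (Finset.mem_univ i)
  rw [Fin.sum_univ_three]
  linarith [this 0, this 1, this 2]

/-- Second-moment increment bound for the interpolated membrane model in
`d = 3`: fix `A > 0`; there is `C > 0` depending only on `A` such that for every `N ≥ 2`
and every centered Gaussian field on `ℤ³` vanishing outside `V_{N-1} = [-(N-1), N-1]³`
whose covariance has first differences and second mixed differences bounded by `A`, the
interpolation `Ψ_N` satisfies `E[(Ψ_N(t) - Ψ_N(s))²] ≤ C ‖t-s‖` on `[-1,1]³`. -/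
theorem statement10 (A : ℝ) (hA : 0 < A) :
    ∃ C : ℝ, 0 < C ∧ ∀ N : ℕ, 2 ≤ N →
      ∀ (Ω : Type) [MeasurableSpace Ω] (P : Measure Ω), IsProbabilityMeasure P →
      ∀ φ : (Fin 3 → ℤ) → Ω → ℝ,
        (∀ c : (Fin 3 → ℤ) →₀ ℝ, ∃ v : NNReal,
          Measure.map (fun ω => ∑ x ∈ c.support, c x * φ x ω) P = gaussianReal 0 v) →
        (∀ x : Fin 3 → ℤ, ¬ (∀ i, |x i| ≤ (N : ℤ) - 1) → ∀ᵐ ω ∂P, φ x ω = 0) →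
        (∀ (x y : Fin 3 → ℤ) (i : Fin 3),
          |covG3 P φ (x + unitZ3 i) y - covG3 P φ x y| ≤ A) →
        (∀ (x y : Fin 3 → ℤ) (i j : Fin 3),
          |covG3 P φ (x + unitZ3 i) (y + unitZ3 j) - covG3 P φ (x + unitZ3 i) y -
              covG3 P φ x (y + unitZ3 j) + covG3 P φ x y| ≤ A) →
        ∀ s t : Fin 3 → ℝ, (∀ i, |s i| ≤ 1) → (∀ i, |t i| ≤ 1) →
          (∫ ω, (interp3 N φ t ω - interp3 N φ s ω) ^ 2 ∂P)
            ≤ C * rnorm3 (t - s) := by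
  refine ⟨A, hA, ?_⟩
  intro N hN Ω _ P _ φ hgauss _ hG _ s t _ _
  have hm := main3 P φ (gauss_memLp P φ hgauss) A hG
    (fun i => (N:ℝ) * t i) (fun i => (N:ℝ) * s i)
  have hN0 : (0:ℝ) < N := by exact_mod_cast (by omega : 0 < N)
  have e : ∀ ω, (interp3 N φ t ω - interp3 N φ s ω) ^ 2 = (1 / (36 * N)) *
      (I3 (fun i => (N:ℝ) * t i) (fun x => φ x ω) -
        I3 (fun i => (N:ℝ) * s i) (fun x => φ x ω)) ^ 2 := by
    intro ω
    rw [interp3_eq, interp3_eq, ← mul_sub, mul_pow, div_pow, Real.sq_sqrt hN0.le]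
    congr 1
    field_simp
    norm_num
  simp only [e]
  rw [integral_const_mul]
  have hs : ∑ i, |(N:ℝ) * t i - N * s i| = N * ∑ i, |(t - s) i| := by
    rw [Finset.mul_sum]
    refine Finset.sum_congr rfl fun i _ => ?_
    rw [← mul_sub, abs_mul, abs_of_pos hN0]; rfl
  rw [hs] at hm
  have hl := l1_le (t - s)
  have hr : 0 ≤ rnorm3 (t - s) := Real.sqrt_nonneg _
  calc _ ≤ (1 / (36 * (N:ℝ))) * (2 * (A * (N * ∑ i, |(t - s) i|))) := by gcongr
    _ = A / 18 * ∑ i, |(t - s) i| := by field_simp; ring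
    _ ≤ A / 18 * (3 * rnorm3 (t - s)) := by gcongr
    _ ≤ A * rnorm3 (t - s) := by nlinarith [mul_nonneg hA.le hr]
end
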